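/- arXiv:2602.14064 — 3 statements merged into one kernel-verified Lean document; each statement's English description precedes it below -/
import Mathlib

section
/- Let λ = (λ_1,…,λ_n) ∈ Γ₂ with λ_1 ≥ λ_2 ≥ ⋯ ≥ λ_n, let f(λ) = σ₂(λ)/σ₁(λ) and f_1 = ∂f/∂λ_1 = σ_{1;1}(λ)/σ₁(λ) − σ₂(λ)/σ₁(λ)². Then f_1 λ_1² ≥ (2/n²) f(λ)². -/
/-- The `k`-th elementary symmetric function of `l : Fin n → ℝ`. -/
noncomputable def esymm (n k : ℕ) (l : Fin n → ℝ) : ℝ :=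
  ∑ s ∈ Finset.univ.powersetCard k, ∏ i ∈ s, l i

theorem Finset.two_mul_sum_powersetCard_two_prod {ι R : Type*} [CommRing R]
    (s : Finset ι) (f : ι → R) :
    2 * ∑ t ∈ s.powersetCard 2, ∏ i ∈ t, f i = (∑ i ∈ s, f i) ^ 2 - ∑ i ∈ s, f i ^ 2 := by
  classical
  induction s using Finset.induction_on with
  | empty => rw [Finset.powersetCard_eq_empty.2 (by simp)]; simp
  | insert a s ha ih =>
    have hdisj : Disjoint (s.powersetCard 2) ((s.powersetCard 1).image (insert a)) := by
      refine Finset.disjoint_left.2 fun t ht ht' => ?_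
      obtain ⟨u, -, rfl⟩ := Finset.mem_image.1 ht'
      exact ha ((Finset.mem_powersetCard.1 ht).1 (Finset.mem_insert_self a u))
    have himage : ∑ t ∈ (s.powersetCard 1).image (insert a), ∏ i ∈ t, f i
        = f a * ∑ i ∈ s, f i := by
      rw [Finset.sum_image, Finset.powersetCard_one, Finset.sum_map, Finset.mul_sum]
      · refine Finset.sum_congr rfl fun i hi => ?_
        have hai : a ≠ i := fun h => ha (h ▸ hi)
        simp [Finset.prod_pair hai]
      · intro t ht u hu h
        have hat : a ∉ t := fun h => ha ((Finset.mem_powersetCard.1 ht).1 h)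
        have hau : a ∉ u := fun h => ha ((Finset.mem_powersetCard.1 hu).1 h)
        rw [← Finset.erase_insert hat, ← Finset.erase_insert hau]
        exact congrArg (fun v => v.erase a) h
    rw [Finset.powersetCard_succ_insert ha, Finset.sum_union hdisj, himage,
      Finset.sum_insert ha, Finset.sum_insert ha, mul_add, ih]
    ring

theorem esymm_one (n : ℕ) (l : Fin n → ℝ) : esymm n 1 l = ∑ i, l i := by
  simp [esymm, Finset.powersetCard_one]

theorem two_mul_esymm_two (n : ℕ) (l : Fin n → ℝ) :
    2 * esymm n 2 l = (∑ i, l i) ^ 2 - ∑ i, l i ^ 2 :=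
  Finset.two_mul_sum_powersetCard_two_prod _ l

/-- for `λ ∈ Γ₂` ordered decreasingly, with `f = σ₂/σ₁` and
`f₁ = σ_{1;1}/σ₁ − σ₂/σ₁²`, one has `f₁ λ₁² ≥ (2/n²) f(λ)²`. -/
theorem stmt5 (n : ℕ) (hn : 0 < n) (l : Fin n → ℝ)
    (hΓ1 : 0 < esymm n 1 l) (hΓ2 : 0 < esymm n 2 l)
    (hord : ∀ i j : Fin n, i ≤ j → l j ≤ l i) :
    (esymm n 1 (Function.update l ⟨0, hn⟩ 0) / esymm n 1 l
        - esymm n 2 l / (esymm n 1 l) ^ 2) * (l ⟨0, hn⟩) ^ 2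
      ≥ 2 / (n : ℝ) ^ 2 * (esymm n 2 l / esymm n 1 l) ^ 2 := by
  obtain ⟨m, rfl⟩ : ∃ m, n = m + 1 := ⟨n - 1, by omega⟩
  have hzero : (⟨0, hn⟩ : Fin (m + 1)) = 0 := rfl
  have hupdate : esymm (m + 1) 1 (Function.update l 0 0) = ∑ i : Fin m, l i.succ := by
    simp [esymm_one, Fin.sum_univ_succ]
  have hS := esymm_one (m + 1) l
  have hP := two_mul_esymm_two (m + 1) l
  rw [Fin.sum_univ_succ] at hS
  rw [Fin.sum_univ_succ, Fin.sum_univ_succ] at hP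
  have hcauchy : (∑ i : Fin m, l i.succ) ^ 2 ≤ m * ∑ i : Fin m, l i.succ ^ 2 := by
    simpa using sq_sum_le_card_mul_sum_sq (s := Finset.univ) (f := fun i : Fin m => l i.succ)
  have hmax : ∑ i : Fin m, l i.succ ≤ m * l 0 := by
    simpa using Finset.sum_le_sum fun (i : Fin m) (_ : i ∈ Finset.univ) =>
      hord 0 i.succ (Fin.zero_le _)
  have hq : 0 ≤ ∑ i : Fin m, l i.succ ^ 2 := Finset.sum_nonneg fun i _ => sq_nonneg _
  rw [hzero, hupdate]
  generalize ∑ i : Fin m, l i.succ = b at *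
  generalize ∑ i : Fin m, l i.succ ^ 2 = q at *
  generalize esymm (m + 1) 1 l = S at *
  generalize esymm (m + 1) 2 l = P at *
  generalize l 0 = a at *
  subst hS
  have ha : 0 < a := by
    have hm : (0 : ℝ) ≤ m := m.cast_nonneg
    by_contra! ha
    nlinarith
  have hb : 0 < b := by
    by_contra! hb
    nlinarith
  have hm : (1 : ℝ) ≤ m := by
    rcases Nat.eq_zero_or_pos m with rfl | hm
    · norm_num at hmax
      linarith
    · exact_mod_cast hm
  have hbound : 2 * P ≤ (m + 1) * (a * b) := by
    have hab : (m - 1) * b * b ≤ (m - 1) * b * (m * a) :=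
      mul_le_mul_of_nonneg_left hmax (mul_nonneg (by linarith) hb.le)
    refine le_of_mul_le_mul_left ?_ (by linarith : (0 : ℝ) < m)
    rw [hP]
    linarith
  have hsq : (2 * P) ^ 2 ≤ ((m + 1) * (a * b)) ^ 2 :=
    pow_le_pow_left₀ (by linarith) hbound 2
  have hlhs : (b / (a + b) - P / (a + b) ^ 2) * a ^ 2
      = (b ^ 2 + q) * a ^ 2 / 2 / (a + b) ^ 2 := by
    obtain rfl : P = ((a + b) ^ 2 - (a ^ 2 + q)) / 2 := by linarith
    field_simp
    ring
  have hrhs : 2 / ((m : ℝ) + 1) ^ 2 * (P / (a + b)) ^ 2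
      = 2 * P ^ 2 / (m + 1) ^ 2 / (a + b) ^ 2 := by
    field_simp
  push_cast
  rw [hlhs, hrhs, ge_iff_le]
  refine div_le_div_of_nonneg_right ?_ (sq_nonneg _)
  rw [div_le_iff₀ (by positivity)]
  have hqa : 0 ≤ q * (a * ((m : ℝ) + 1)) ^ 2 := by positivity
  linarith
end

section
/- Let λ = (λ_1,…,λ_n) ∈ Γ₂ with λ_1 ≥ λ_2 ≥ ⋯ ≥ λ_n, let f(λ) = σ₂(λ)/σ₁(λ) and f_1 = σ_{1;1}(λ)/σ₁(λ) − σ₂(λ)/σ₁(λ)². Then f_1 ≤ (n−1)/n − f(λ)/σ₁(λ). -/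
/-- for `λ ∈ Γ₂` ordered decreasingly, with `f = σ₂/σ₁` and
`f₁ = σ_{1;1}/σ₁ − σ₂/σ₁²`, one has `f₁ ≤ (n−1)/n − f(λ)/σ₁(λ)`. -/
theorem stmt6 (n : ℕ) (hn : 0 < n) (l : Fin n → ℝ)
    (hΓ1 : 0 < esymm n 1 l) (hΓ2 : 0 < esymm n 2 l)
    (hord : ∀ i j : Fin n, i ≤ j → l j ≤ l i) :
    esymm n 1 (Function.update l ⟨0, hn⟩ 0) / esymm n 1 l
        - esymm n 2 l / (esymm n 1 l) ^ 2
      ≤ ((n : ℝ) - 1) / n - (esymm n 2 l / esymm n 1 l) / esymm n 1 l := by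
  have hmean : esymm n 1 l ≤ n * l ⟨0, hn⟩ := by
    rw [esymm_one]
    simpa using Finset.sum_le_card_nsmul Finset.univ l (l ⟨0, hn⟩)
      fun i _ => hord ⟨0, hn⟩ i (Nat.zero_le i)
  have hupdate : esymm n 1 (Function.update l ⟨0, hn⟩ 0) = esymm n 1 l - l ⟨0, hn⟩ := by
    rw [esymm_one, esymm_one, Finset.sum_update_of_mem (Finset.mem_univ _), zero_add,
      Finset.sum_sdiff_eq_sub (Finset.subset_univ _), Finset.sum_singleton]
  have hn' : (0 : ℝ) < n := Nat.cast_pos.2 hn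
  rw [div_div, ← sq, hupdate]
  refine sub_le_sub_right ?_ _
  rw [div_le_div_iff₀ hΓ1 hn']
  linarith
end

section
/- Let λ = (λ_1,…,λ_n) ∈ Γ₂ with λ_1 ≥ λ_2 ≥ ⋯ ≥ λ_n, let f(λ) = σ₂(λ)/σ₁(λ) and f_i = σ_{1;i}(λ)/σ₁(λ) − σ₂(λ)/σ₁(λ)². Then for every i ≥ 2, f_i ≤ 2(n−1)/n − f(λ)/σ₁(λ). -/
/-- Newton's identity in degree two: `2 σ₂ = σ₁² - ∑ l i ^ 2`. -/
theorem two_mul_sum_powersetCard_two {ι R : Type*} [CommRing R] (s : Finset ι) (l : ι → R) :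
    2 * ∑ t ∈ s.powersetCard 2, ∏ i ∈ t, l i = (∑ i ∈ s, l i) ^ 2 - ∑ i ∈ s, l i ^ 2 := by
  classical
  induction s using Finset.induction_on with
  | empty =>
    have h : (∅ : Finset ι).powersetCard 2 = ∅ := Finset.powersetCard_eq_empty.2 (by simp)
    simp [h]
  | insert a s ha ih =>
    have hdisj : Disjoint (s.powersetCard 2) ((s.powersetCard 1).image (insert a)) := by
      rw [Finset.disjoint_left]
      intro t ht h
      obtain ⟨u, -, rfl⟩ := Finset.mem_image.1 h
      exact ha ((Finset.mem_powersetCard.1 ht).1 (Finset.mem_insert_self a u))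
    have himage : ∑ t ∈ (s.powersetCard 1).image (insert a), ∏ i ∈ t, l i
        = l a * ∑ i ∈ s, l i := by
      rw [Finset.powersetCard_one, Finset.map_eq_image, Finset.image_image,
        Finset.sum_image, Finset.mul_sum]
      · refine Finset.sum_congr rfl fun x hx => ?_
        have hax : a ≠ x := fun h => ha (h ▸ hx)
        simp [Finset.prod_pair hax]
      · intro x hx y hy h
        have hxa : x ≠ a := fun e => ha (e ▸ hx)
        have hmem : x ∈ ({a, y} : Finset ι) := by
          have : ({a, x} : Finset ι) = {a, y} := h
          simp [← this]
        simpa [hxa] using hmem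
    rw [Finset.powersetCard_succ_insert ha, Finset.sum_union hdisj, himage,
      Finset.sum_insert ha, Finset.sum_insert ha, mul_add, ih]
    ring

/-- On `Γ₂`, every entry satisfies `l i ≥ -((n - 2) / n) σ₁`. -/
theorem neg_mul_esymm_one_le (n : ℕ) (l : Fin n → ℝ)
    (h₁ : 0 < esymm n 1 l) (h₂ : 0 < esymm n 2 l) (i : Fin n) :
    -((n : ℝ) - 2) * esymm n 1 l ≤ n * l i := by
  have hnewton := two_mul_sum_powersetCard_two Finset.univ l
  change 2 * esymm n 2 l = _ at hnewton
  rw [← esymm_one] at hnewton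
  have hsum := Finset.add_sum_erase Finset.univ l (Finset.mem_univ i)
  have hsq := Finset.add_sum_erase Finset.univ (fun j => l j ^ 2) (Finset.mem_univ i)
  rw [← esymm_one] at hsum
  have hcs := sq_sum_le_card_mul_sum_sq (s := Finset.univ.erase i) (f := l)
  have hnonneg : 0 ≤ ∑ j ∈ Finset.univ.erase i, l j ^ 2 :=
    Finset.sum_nonneg fun j _ => sq_nonneg _
  have hn : 1 ≤ n := i.pos
  rw [Finset.card_erase_of_mem (Finset.mem_univ i), Finset.card_univ, Fintype.card_fin,
    Nat.cast_sub hn, Nat.cast_one] at hcs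
  have hn' : (1 : ℝ) ≤ n := by exact_mod_cast hn
  set S := esymm n 1 l
  set Q := ∑ j ∈ Finset.univ.erase i, l j ^ 2
  have hrest : ∑ j ∈ Finset.univ.erase i, l j = S - l i := by linarith
  rw [hrest] at hcs
  have hQ : Q < (S - l i) * (S + l i) := by nlinarith
  have hlt : l i < S := by nlinarith
  have hmul : (S - l i) * (S - l i) ≤ (S - l i) * ((n - 1) * (S + l i)) := by
    nlinarith [mul_le_mul_of_nonneg_left hQ.le (sub_nonneg.2 hn')]
  have hle := le_of_mul_le_mul_left hmul (sub_pos.2 hlt)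
  linarith

/-- for `λ ∈ Γ₂` ordered decreasingly, with `f = σ₂/σ₁` and
`f_i = σ_{1;i}/σ₁ − σ₂/σ₁²`, for every `i ≥ 2` (i.e. every index other than the first)
one has `f_i ≤ 2(n−1)/n − f(λ)/σ₁(λ)`. -/
theorem stmt8 (n : ℕ) (l : Fin n → ℝ)
    (hΓ1 : 0 < esymm n 1 l) (hΓ2 : 0 < esymm n 2 l)
    (hord : ∀ i j : Fin n, i ≤ j → l j ≤ l i)
    (i : Fin n) (hi : 1 ≤ (i : ℕ)) :
    esymm n 1 (Function.update l i 0) / esymm n 1 l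
        - esymm n 2 l / (esymm n 1 l) ^ 2
      ≤ 2 * ((n : ℝ) - 1) / n - (esymm n 2 l / esymm n 1 l) / esymm n 1 l := by
  have hbound := neg_mul_esymm_one_le n l hΓ1 hΓ2 i
  have hn : (0 : ℝ) < n := by exact_mod_cast i.pos
  have hupdate : esymm n 1 (Function.update l i 0) = esymm n 1 l - l i := by
    rw [esymm_one, esymm_one, Finset.sum_update_of_mem (Finset.mem_univ i),
      ← Finset.add_sum_erase Finset.univ l (Finset.mem_univ i), Finset.sdiff_singleton_eq_erase]
    ring
  rw [hupdate, div_div, ← sq]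
  refine sub_le_sub_right ?_ _
  rw [div_le_div_iff₀ hΓ1 hn]
  linarith
end
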